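/- Let S be a 0-left cancellative semigroup with zero equipped with a homogeneous N-valued length function ℓ, where N is a totally ordered set. Let r ∈ S and let σ be an unbounded string with σ ∈ E⋆_r. Then: (i) θ⋆_r^{-1}(σ) is unbounded; (ii) any string μ containing θ⋆_r^{-1}(σ) belongs to F⋆_r; (iii) if σ is a maximal string, then θ⋆_r^{-1}(σ) is a maximal string. -/

import Mathlib

/-- A semigroup with zero is `0`-left cancellative if `s*t = s*r ≠ 0` implies `t = r`. -/
def ZeroLeftCancellative (S : Type*) [SemigroupWithZero S] : Prop :=
  ∀ s t r : S, s * t = s * r → s * t ≠ 0 → t = r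

/-- `s` divides `t` when `t ∈ {s} ∪ sS`. -/
def Divides {S : Type*} [Mul S] (s t : S) : Prop := t = s ∨ ∃ u, s * u = t

/-- A string in `S`: a nonempty subset not containing `0`, closed under divisors,
and directed with respect to divisibility. -/
def IsString {S : Type*} [SemigroupWithZero S] (σ : Set S) : Prop :=
  σ.Nonempty ∧ (0 : S) ∉ σ ∧
  (∀ s t : S, Divides s t → t ∈ σ → s ∈ σ) ∧
  (∀ s₁ ∈ σ, ∀ s₂ ∈ σ, ∃ s ∈ σ, Divides s₁ s ∧ Divides s₂ s)

/-- `r ∗ σ`, the set of divisors of elements of `rσ`. -/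
def star {S : Type*} [SemigroupWithZero S] (r : S) (σ : Set S) : Set S :=
  {t | ∃ s ∈ σ, Divides t (r * s)}

/-- `r⁻¹ ∗ σ = {t ∈ S : rt ∈ σ}`. -/
def starInv {S : Type*} [SemigroupWithZero S] (r : S) (σ : Set S) : Set S :=
  {t | r * t ∈ σ}

/-- `F⋆_r`, the domain of `θ⋆_r`: the strings `σ` with `0 ∉ rσ`. -/
def Fstar {S : Type*} [SemigroupWithZero S] (r : S) : Set (Set S) :=
  {σ | IsString σ ∧ ∀ s ∈ σ, r * s ≠ 0}

/-- `E⋆_r`, the range of `θ⋆_r`: the strings `σ` with `σ ∩ rS ≠ ∅`. -/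
def Estar {S : Type*} [SemigroupWithZero S] (r : S) : Set (Set S) :=
  {σ | IsString σ ∧ ∃ t ∈ σ, ∃ x, t = r * x}

theorem Divides.mul_left {S : Type*} [Semigroup S] {s t : S} (h : Divides s t) (r : S) :
    Divides (r * s) (r * t) := by
  rcases h with rfl | ⟨u, rfl⟩
  · exact Or.inl rfl
  · exact Or.inr ⟨u, mul_assoc r s u⟩

theorem ZeroLeftCancellative.divides_of_mul_left {S : Type*} [SemigroupWithZero S]
    (hlc : ZeroLeftCancellative S) {r s t : S} (h0 : r * t ≠ 0)
    (h : Divides (r * s) (r * t)) : Divides s t := by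
  rcases h with h | ⟨u, h⟩
  · exact Or.inl (hlc r t s h h0)
  · exact Or.inr ⟨u, (hlc r t (s * u) (by rw [← h, mul_assoc]) h0).symm⟩

theorem Divides.exists_eq_mul {S : Type*} [Semigroup S] {r x v : S} (h : Divides (r * x) v) :
    ∃ y, v = r * y := by
  rcases h with rfl | ⟨u, rfl⟩
  · exact ⟨x, rfl⟩
  · exact ⟨x * u, mul_assoc r x u⟩

theorem IsString.ne_zero {S : Type*} [SemigroupWithZero S] {σ : Set S} (hσ : IsString σ) {s : S}
    (hs : s ∈ σ) : s ≠ 0 :=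
  fun h => hσ.2.1 (h ▸ hs)

theorem exists_divides_mul_of_mem_Estar {S : Type*} [SemigroupWithZero S] {r : S} {σ : Set S}
    (hE : σ ∈ Estar r) {s : S} (hs : s ∈ σ) : ∃ y ∈ starInv r σ, Divides s (r * y) := by
  obtain ⟨hσ, _, hx, x, rfl⟩ := hE
  obtain ⟨v, hv, hsv, hxv⟩ := hσ.2.2.2 s hs _ hx
  obtain ⟨y, rfl⟩ := hxv.exists_eq_mul
  exact ⟨y, hv, hsv⟩

theorem isString_starInv {S : Type*} [SemigroupWithZero S] (hlc : ZeroLeftCancellative S)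
    {r : S} {σ : Set S} (hE : σ ∈ Estar r) : IsString (starInv r σ) := by
  obtain ⟨hσ, _, hx, x, rfl⟩ := hE
  refine ⟨⟨x, hx⟩, fun h => hσ.ne_zero h (mul_zero r),
    fun s t hst ht => hσ.2.2.1 _ _ (hst.mul_left r) ht, fun s hs t ht => ?_⟩
  obtain ⟨v, hv, hsv, htv⟩ := hσ.2.2.2 _ hs _ ht
  obtain ⟨y, rfl⟩ := hsv.exists_eq_mul
  have h0 := hσ.ne_zero hv
  exact ⟨y, hv, hlc.divides_of_mul_left h0 hsv, hlc.divides_of_mul_left h0 htv⟩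

/-- With respect to a length function, every unbounded string is maximal. -/
theorem IsString.eq_of_subset_of_unbounded {S N : Type*} [SemigroupWithZero S] [LinearOrder N]
    {ℓ : S → N}
    (hdiv : ∀ r s t : S, s * t ≠ 0 → Divides r (s * t) → ℓ r ≤ ℓ s → Divides r s)
    {σ τ : Set S} (hσ : IsString σ) (hunb : ¬ ∃ n : N, ∀ s ∈ σ, ℓ s ≤ n)
    (hτ : IsString τ) (h : σ ⊆ τ) : σ = τ := by
  refine h.antisymm fun s hs => ?_
  obtain ⟨t, ht, hlt⟩ : ∃ t ∈ σ, ℓ s < ℓ t := by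
    by_contra! hb
    exact hunb ⟨ℓ s, hb⟩
  obtain ⟨v, hv, hsv, htv⟩ := hτ.2.2.2 s hs t (h ht)
  refine hσ.2.2.1 s t ?_ ht
  rcases htv with rfl | ⟨u, rfl⟩
  · exact hsv
  · exact hdiv s t u (hτ.ne_zero hv) hsv hlt.le


/-- Let `S` carry a homogeneous `N`-valued length function and let `σ` be an unbounded
string in `E⋆_r`.  Then (i) `θ⋆_r⁻¹(σ)` is unbounded; (ii) every string containing
`θ⋆_r⁻¹(σ)` lies in `F⋆_r`; (iii) if `σ` is maximal then so is `θ⋆_r⁻¹(σ)`. -/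
theorem strings.unboundedBackwardInvariance {S N : Type*} [SemigroupWithZero S]
    [LinearOrder N]
    (hlc : ZeroLeftCancellative S)
    (ℓ : S → N)
    (hmono : ∀ s t : S, t ≠ 0 → Divides s t → ℓ s ≤ ℓ t)
    (hdiv : ∀ r s t : S, s * t ≠ 0 → Divides r (s * t) → ℓ r ≤ ℓ s → Divides r s)
    (hhom : ∀ r : S, ∀ X : Set S, (∀ x ∈ X, x ≠ 0 ∧ r * x ≠ 0) →
        (∃ n : N, ∀ x ∈ X, ℓ x ≤ n) → ∃ n : N, ∀ x ∈ X, ℓ (r * x) ≤ n)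
    (r : S) (σ : Set S) (hσ : IsString σ) (hE : σ ∈ Estar r)
    (hunb : ¬ ∃ n : N, ∀ s ∈ σ, ℓ s ≤ n) :
    (¬ ∃ n : N, ∀ s ∈ starInv r σ, ℓ s ≤ n) ∧
    (∀ μ : Set S, IsString μ → starInv r σ ⊆ μ → μ ∈ Fstar r) ∧
    ((∀ τ : Set S, IsString τ → σ ⊆ τ → σ = τ) →
      IsString (starInv r σ) ∧
        ∀ τ : Set S, IsString τ → starInv r σ ⊆ τ → starInv r σ = τ) := by
  have hstr := isString_starInv hlc hE
  have hinv : ¬ ∃ n : N, ∀ s ∈ starInv r σ, ℓ s ≤ n := by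
    intro hb
    obtain ⟨m, hm⟩ := hhom r (starInv r σ) (fun x hx => ⟨hstr.ne_zero hx, hσ.ne_zero hx⟩) hb
    refine hunb ⟨m, fun s hs => ?_⟩
    obtain ⟨y, hy, hsy⟩ := exists_divides_mul_of_mem_Estar hE hs
    exact (hmono s _ (hσ.ne_zero hy) hsy).trans (hm y hy)
  have hmax : ∀ τ : Set S, IsString τ → starInv r σ ⊆ τ → starInv r σ = τ :=
    fun τ hτ h => hstr.eq_of_subset_of_unbounded hdiv hinv hτ h
  refine ⟨hinv, fun μ hμ h => ?_, fun _ => ⟨hstr, hmax⟩⟩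
  obtain rfl := hmax μ hμ h
  exact ⟨hstr, fun s hs => hσ.ne_zero hs⟩
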